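/- Fix M > 1 and τ ∈ [0,1]; let c = 2/(1 + M^{−τ}) and μ = (4/π) arctan M^{−(1−τ)/2}. Let w_τ be the 2π-periodic function with w_τ(θ) = sin( μ(θ/c − π/4) ) for θ ∈ [0, cπ/2), w_τ(θ) = M^{−(1−τ)/2} cos( μ( M^{τ}(θ − cπ/2)/c − π/4 ) ) for θ ∈ [cπ/2, π), and w_τ(θ + π) = −w_τ(θ), and define u_τ on the closed unit disk by u_τ(x) = |x|^{μ/c} w_τ(arg x) for x ≠ 0 and u_τ(0) = 0. Then u_τ is Hölder continuous with exponent μ/c on the closed unit disk, and for every α with μ/c < α ≤ 1 there is no neighborhood U of 0 and constant C > 0 such that |u_τ(x) − u_τ(y)| ≤ C|x − y|^α for all x, y ∈ U; that is, the Hölder exponent of u_τ is exactly μ/c. -/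

import Mathlib

open MeasureTheory Real Set Matrix intervalIntegral
open scoped Classical

noncomputable section

abbrev V2 := EuclideanSpace ℝ (Fin 2)

def toV (v : Fin 2 → ℝ) : V2 := (WithLp.equiv 2 (Fin 2 → ℝ)).symm v

def dot2 (v w : Fin 2 → ℝ) : ℝ := v 0 * w 0 + v 1 * w 1

def quad (A : Matrix (Fin 2) (Fin 2) ℝ) (ξ : Fin 2 → ℝ) : ℝ := dot2 ξ (A.mulVec ξ)

def eit (t : ℝ) : V2 := toV ![Real.cos t, Real.sin t]

/-- The angular polar coordinate `arg y ∈ [0, 2π)` of `y ∈ ℝ²` (with `arg 0 = 0`). -/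
def arg2 (x : V2) : ℝ :=
  if 0 ≤ Complex.arg (Complex.mk (x 0) (x 1)) then Complex.arg (Complex.mk (x 0) (x 1))
  else Complex.arg (Complex.mk (x 0) (x 1)) + 2 * π

/-- The rotation matrix `J(t)`. -/
def Jmat (t : ℝ) : Matrix (Fin 2) (Fin 2) ℝ :=
  !![Real.cos t, -Real.sin t; Real.sin t, Real.cos t]

/-- `c = 2/(1 + M^{−τ})`. -/
def cM (M τ : ℝ) : ℝ := 2 / (1 + M ^ (-τ))

/-- The piecewise-constant matrix `K_τ`: the identity on the cone
`arg x ∈ [0, cπ/2) ∪ [π, π + cπ/2)` and `diag(M, M^{1−2τ})` otherwise. -/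
def Ktau (M τ : ℝ) (x : V2) : Matrix (Fin 2) (Fin 2) ℝ :=
  if arg2 x ∈ Ico 0 (cM M τ * π / 2) ∪ Ico π (π + cM M τ * π / 2) then 1
  else Matrix.diagonal ![M, M ^ (1 - 2 * τ)]

/-- The coefficient matrix `A_τ(x) = J(arg x) K_τ(x) J(arg x)ᵀ`. -/
def Atau (M τ : ℝ) (x : V2) : Matrix (Fin 2) (Fin 2) ℝ :=
  Jmat (arg2 x) * Ktau M τ x * (Jmat (arg2 x))ᵀ

/-- `f(x, ρ) = (1/2π) ∫₀^{2π} ⟨e^{it}, A_τ(x + ρe^{it}) e^{it}⟩ / √(det A_τ(x + ρe^{it})) dt`. -/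
def ftau (M τ : ℝ) (x : V2) (ρ : ℝ) : ℝ :=
  (1 / (2 * π)) * ∫ t in (0 : ℝ)..(2 * π),
    quad (Atau M τ (x + ρ • eit t)) (eit t) / Real.sqrt ((Atau M τ (x + ρ • eit t)).det)

/-- `μ = (4/π) arctan M^{−(1−τ)/2}`. -/
def muM (M τ : ℝ) : ℝ := (4 / π) * arctan (M ^ (-(1 - τ) / 2))

/-- The profile `w_τ` on `[0, π)`. -/
def wbase (M τ : ℝ) (θ : ℝ) : ℝ :=
  if θ < cM M τ * π / 2 then Real.sin (muM M τ * (θ / cM M τ - π / 4))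
  else M ^ (-(1 - τ) / 2) *
    Real.cos (muM M τ * (M ^ τ * (θ - cM M τ * π / 2) / cM M τ - π / 4))

/-- The function `w_τ` on `ℝ`, extended from `[0, π)` by `w_τ(θ + π) = −w_τ(θ)`. -/
def wtau (M τ : ℝ) (θ : ℝ) : ℝ :=
  (-1 : ℝ) ^ ⌊θ / π⌋ * wbase M τ (θ - π * ⌊θ / π⌋)

/-- The function `u_τ(x) = |x|^{μ/c} w_τ(arg x)` (with `u_τ(0) = 0`). -/
def utau (M τ : ℝ) (x : V2) : ℝ :=
  if x = 0 then 0 else ‖x‖ ^ (muM M τ / cM M τ) * wtau M τ (arg2 x)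

lemma abs_piecewise_sub_le {f g : ℝ → ℝ} {L κ : ℝ} (hf : ∀ a b, |f a - f b| ≤ L * |a - b|)
    (hg : ∀ a b, |g a - g b| ≤ L * |a - b|) (hκ : f κ = g κ) (a b : ℝ) :
    |(if a < κ then f a else g a) - (if b < κ then f b else g b)| ≤ L * |a - b| := by
  have cross : ∀ x y, x < κ → κ ≤ y → |f x - g y| ≤ L * |x - y| := by
    intro x y hx hy
    have h1 := hf x κ
    have h2 := hg κ y
    rw [abs_of_nonpos (by linarith : x - κ ≤ 0)] at h1
    rw [abs_of_nonpos (by linarith : κ - y ≤ 0)] at h2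
    rw [abs_of_nonpos (by linarith : x - y ≤ 0)]
    calc |f x - g y| ≤ |f x - f κ| + |g κ - g y| := by
          rw [← hκ]; exact abs_sub_le _ _ _
      _ ≤ L * -(x - y) := by linarith
  split_ifs with ha hb hb
  · exact hf a b
  · exact cross a b ha (not_lt.mp hb)
  · rw [abs_sub_comm, abs_sub_comm a b]
    exact cross b a hb (not_lt.mp ha)
  · exact hg a b

section Parameters

variable {M τ : ℝ}

lemma one_le_cM (hM : 1 < M) (hτ0 : 0 ≤ τ) : 1 ≤ cM M τ := by
  have h0 : 0 < M ^ (-τ) := rpow_pos_of_pos (by linarith) _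
  have h1 : M ^ (-τ) ≤ 1 := rpow_le_one_of_one_le_of_nonpos hM.le (by linarith)
  rw [cM, le_div_iff₀ (by linarith)]
  linarith

lemma cM_lt_two (hM : 1 < M) : cM M τ < 2 := by
  have h0 : 0 < M ^ (-τ) := rpow_pos_of_pos (by linarith) _
  rw [cM, div_lt_iff₀ (by linarith)]
  linarith

lemma amplitude_pos (hM : 1 < M) : 0 < M ^ (-(1 - τ) / 2) :=
  rpow_pos_of_pos (by linarith) _

lemma amplitude_le_one (hM : 1 < M) (hτ1 : τ ≤ 1) : M ^ (-(1 - τ) / 2) ≤ 1 :=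
  rpow_le_one_of_one_le_of_nonpos hM.le (by linarith)

lemma muM_mul_pi_div_four : muM M τ * (π / 4) = arctan (M ^ (-(1 - τ) / 2)) := by
  rw [muM]
  field_simp

lemma muM_pos (hM : 1 < M) : 0 < muM M τ :=
  mul_pos (by positivity) (arctan_pos.mpr (amplitude_pos hM))

lemma muM_le_one (hM : 1 < M) (hτ1 : τ ≤ 1) : muM M τ ≤ 1 := by
  have h := arctan_le_arctan_iff.mpr (amplitude_le_one hM hτ1)
  rw [arctan_one, ← muM_mul_pi_div_four] at h
  nlinarith [pi_pos]

lemma exponent_pos (hM : 1 < M) (hτ0 : 0 ≤ τ) : 0 < muM M τ / cM M τ :=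
  div_pos (muM_pos hM) (by linarith [one_le_cM hM hτ0])

lemma exponent_le_one (hM : 1 < M) (hτ0 : 0 ≤ τ) (hτ1 : τ ≤ 1) : muM M τ / cM M τ ≤ 1 := by
  have h := one_le_cM hM hτ0
  rw [div_le_one (by linarith)]
  linarith [muM_le_one hM hτ1]

lemma sin_arctan_eq_mul_cos (s : ℝ) : sin (arctan s) = s * cos (arctan s) := by
  rw [← tan_mul_cos (cos_arctan_pos s).ne', tan_arctan]

lemma wbase_lipschitz (hM : 1 < M) (hτ0 : 0 ≤ τ) (hτ1 : τ ≤ 1) (a b : ℝ) :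
    |wbase M τ a - wbase M τ b| ≤ M ^ τ * |a - b| := by
  have hL : 1 ≤ M ^ τ := one_le_rpow hM.le hτ0
  have hc := one_le_cM hM hτ0
  have hβ0 := exponent_pos hM hτ0
  have hβ1 := exponent_le_one hM hτ0 hτ1
  refine abs_piecewise_sub_le (L := M ^ τ) (κ := cM M τ * π / 2)
    (f := fun θ => sin (muM M τ * (θ / cM M τ - π / 4)))
    (g := fun θ => M ^ (-(1 - τ) / 2) *
      cos (muM M τ * (M ^ τ * (θ - cM M τ * π / 2) / cM M τ - π / 4))) ?_ ?_ ?_ a b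
  · intro a b
    refine (abs_sin_sub_sin_le _ _).trans ?_
    have : muM M τ * (a / cM M τ - π / 4) - muM M τ * (b / cM M τ - π / 4)
        = muM M τ / cM M τ * (a - b) := by ring
    rw [this, abs_mul, abs_of_pos hβ0]
    gcongr
    linarith
  · intro a b
    rw [← mul_sub, abs_mul, abs_of_pos (amplitude_pos hM)]
    refine (mul_le_of_le_one_left (abs_nonneg _) (amplitude_le_one hM hτ1)).trans ?_
    refine (abs_cos_sub_cos_le _ _).trans ?_
    have : muM M τ * (M ^ τ * (a - cM M τ * π / 2) / cM M τ - π / 4)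
        - muM M τ * (M ^ τ * (b - cM M τ * π / 2) / cM M τ - π / 4)
        = muM M τ / cM M τ * (M ^ τ * (a - b)) := by ring
    rw [this, abs_mul, abs_of_pos hβ0, abs_mul, abs_of_pos (by linarith : 0 < M ^ τ)]
    exact mul_le_of_le_one_left (by positivity) hβ1
  · have h1 : muM M τ * (cM M τ * π / 2 / cM M τ - π / 4) = muM M τ * (π / 4) := by
      field_simp
      ring
    have h2 : muM M τ * (M ^ τ * (cM M τ * π / 2 - cM M τ * π / 2) / cM M τ - π / 4)
        = -(muM M τ * (π / 4)) := by ring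
    rw [h1, h2, cos_neg, muM_mul_pi_div_four, sin_arctan_eq_mul_cos]

lemma wbase_zero (hM : 1 < M) (hτ0 : 0 ≤ τ) :
    wbase M τ 0 = -sin (arctan (M ^ (-(1 - τ) / 2))) := by
  have hc := one_le_cM hM hτ0
  rw [wbase, if_pos (by positivity), ← muM_mul_pi_div_four, ← sin_neg]
  congr 1
  ring

lemma wbase_pi (hM : 1 < M) (hτ0 : 0 ≤ τ) : wbase M τ π = -wbase M τ 0 := by
  have hc2 := cM_lt_two (τ := τ) hM
  have h0 : 0 < M ^ τ := rpow_pos_of_pos (by linarith) _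
  have key : M ^ τ * (π - cM M τ * π / 2) / cM M τ = π / 2 := by
    rw [cM, rpow_neg (by linarith)]
    field_simp
    ring
  rw [wbase_zero hM hτ0, wbase, if_neg (by nlinarith [pi_pos]), key, neg_neg,
    sin_arctan_eq_mul_cos, ← muM_mul_pi_div_four]
  congr 3
  ring

lemma abs_wbase_le_one (hM : 1 < M) (hτ1 : τ ≤ 1) (θ : ℝ) : |wbase M τ θ| ≤ 1 := by
  rw [wbase]
  split_ifs
  · exact abs_sin_le_one _
  · rw [abs_mul, abs_of_pos (amplitude_pos hM)]
    exact mul_le_one₀ (amplitude_le_one hM hτ1) (abs_nonneg _) (abs_cos_le_one _)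

lemma abs_wtau_le_one (hM : 1 < M) (hτ1 : τ ≤ 1) (θ : ℝ) : |wtau M τ θ| ≤ 1 := by
  rw [wtau, abs_mul, abs_zpow, abs_neg, abs_one, _root_.one_zpow, one_mul]
  exact abs_wbase_le_one hM hτ1 _

lemma wtau_of_lt_pi {θ : ℝ} (h0 : 0 ≤ θ) (h1 : θ < π) : wtau M τ θ = wbase M τ θ := by
  have : ⌊θ / π⌋ = 0 := by
    rw [Int.floor_eq_zero_iff]
    exact ⟨by positivity, (div_lt_one pi_pos).mpr h1⟩
  simp [wtau, this]

lemma wtau_of_pi_le {θ : ℝ} (h0 : π ≤ θ) (h1 : θ < 2 * π) :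
    wtau M τ θ = -wbase M τ (θ - π) := by
  have : ⌊θ / π⌋ = 1 := by
    rw [Int.floor_eq_iff]
    constructor
    · rw [Int.cast_one, le_div_iff₀ pi_pos]
      linarith
    · rw [Int.cast_one, div_lt_iff₀ pi_pos]
      linarith
  simp [wtau, this]

lemma le_pi_mul_sin_half {d : ℝ} (h0 : 0 ≤ d) (h1 : d ≤ π) : d ≤ π * sin (d / 2) := by
  have h := Real.mul_le_sin (x := d / 2) (by linarith) (by linarith)
  have := mul_le_mul_of_nonneg_left h pi_pos.le
  calc d = π * (2 / π * (d / 2)) := by field_simp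
    _ ≤ _ := this

lemma wtau_chord_of_le (hM : 1 < M) (hτ0 : 0 ≤ τ) (hτ1 : τ ≤ 1) {a b : ℝ}
    (ha : 0 ≤ a) (hab : a ≤ b) (hb : b < 2 * π) :
    |wtau M τ a - wtau M τ b| ≤ M ^ τ * (π * sin ((b - a) / 2)) := by
  have hL : 0 < M ^ τ := rpow_pos_of_pos (by linarith) _
  have lip : ∀ x y, x ≤ y → |wbase M τ x - wbase M τ y| ≤ M ^ τ * (y - x) := by
    intro x y hxy
    have h := wbase_lipschitz hM hτ0 hτ1 x y
    rwa [abs_sub_comm x y, abs_of_nonneg (sub_nonneg.mpr hxy)] at h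
  have hpi := wbase_pi hM hτ0
  rcases lt_or_ge b π with hbπ | hbπ
  · rw [wtau_of_lt_pi ha (by linarith), wtau_of_lt_pi (by linarith) hbπ]
    refine (lip a b hab).trans ?_
    gcongr
    exact le_pi_mul_sin_half (by linarith) (by linarith)
  rw [wtau_of_pi_le hbπ hb]
  rcases lt_or_ge a π with haπ | haπ
  · rw [wtau_of_lt_pi ha haπ]
    rcases le_total (b - π) a with h | h
    · have h1 := lip a π haπ.le
      have h2 := lip 0 (b - π) (by linarith)
      calc |wbase M τ a - -wbase M τ (b - π)|
          = |(wbase M τ a - wbase M τ π) - (wbase M τ 0 - wbase M τ (b - π))| := by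
            rw [hpi]; ring_nf
        _ ≤ M ^ τ * (b - a) := (abs_sub _ _).trans (by linarith)
        _ ≤ _ := by
            gcongr
            exact le_pi_mul_sin_half (by linarith) (by linarith)
    · have h1 := lip 0 a ha
      have h2 := lip (b - π) π (by linarith)
      have h3 : sin ((b - a) / 2) = sin ((2 * π - (b - a)) / 2) := by
        rw [← sin_pi_sub]
        congr 1
        ring
      calc |wbase M τ a - -wbase M τ (b - π)|
          = |(wbase M τ (b - π) - wbase M τ π) - (wbase M τ 0 - wbase M τ a)| := by
            rw [hpi]; ring_nf
        _ ≤ M ^ τ * (2 * π - (b - a)) := (abs_sub _ _).trans (by linarith)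
        _ ≤ _ := by
            rw [h3]
            gcongr
            exact le_pi_mul_sin_half (by linarith) (by linarith)
  · rw [wtau_of_pi_le haπ (by linarith), neg_sub_neg, abs_sub_comm]
    refine (lip (a - π) (b - π) (by linarith)).trans ?_
    rw [sub_sub_sub_cancel_right]
    gcongr
    exact le_pi_mul_sin_half (by linarith) (by linarith)

lemma wtau_chord (hM : 1 < M) (hτ0 : 0 ≤ τ) (hτ1 : τ ≤ 1) {a b : ℝ}
    (ha : a ∈ Ico 0 (2 * π)) (hb : b ∈ Ico 0 (2 * π)) :
    |wtau M τ a - wtau M τ b| ≤ M ^ τ * (π * |sin ((a - b) / 2)|) := by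
  have hL : 0 < M ^ τ := rpow_pos_of_pos (by linarith) _
  rcases le_total a b with h | h
  · refine (wtau_chord_of_le hM hτ0 hτ1 ha.1 h hb.2).trans ?_
    have : (a - b) / 2 = -((b - a) / 2) := by ring
    rw [this, sin_neg, abs_neg]
    gcongr
    exact le_abs_self _
  · rw [abs_sub_comm]
    refine (wtau_chord_of_le hM hτ0 hτ1 hb.1 h ha.2).trans ?_
    gcongr
    exact le_abs_self _

lemma norm_eq_norm_mk (x : V2) : ‖x‖ = ‖Complex.mk (x 0) (x 1)‖ := by
  rw [EuclideanSpace.norm_eq, Complex.norm_eq_sqrt_sq_add_sq]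
  simp

lemma norm_mul_cos_arg2 (x : V2) : ‖x‖ * cos (arg2 x) = x 0 := by
  rw [norm_eq_norm_mk, arg2]
  split_ifs
  · exact Complex.norm_mul_cos_arg _
  · rw [cos_add_two_pi]
    exact Complex.norm_mul_cos_arg _

lemma norm_mul_sin_arg2 (x : V2) : ‖x‖ * sin (arg2 x) = x 1 := by
  rw [norm_eq_norm_mk, arg2]
  split_ifs
  · exact Complex.norm_mul_sin_arg _
  · rw [sin_add_two_pi]
    exact Complex.norm_mul_sin_arg _

lemma arg2_mem (x : V2) : arg2 x ∈ Ico 0 (2 * π) := by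
  have h1 := Complex.neg_pi_lt_arg (Complex.mk (x 0) (x 1))
  have h2 := Complex.arg_le_pi (Complex.mk (x 0) (x 1))
  rw [arg2]
  split_ifs with h
  · exact ⟨h, by linarith [pi_pos]⟩
  · exact ⟨by linarith, by linarith⟩

lemma dist_sq_polar (x y : V2) :
    dist x y ^ 2 = (‖x‖ - ‖y‖) ^ 2 + 4 * ‖x‖ * ‖y‖ * sin ((arg2 x - arg2 y) / 2) ^ 2 := by
  have h : sin ((arg2 x - arg2 y) / 2) ^ 2 = 1 / 2 - cos (arg2 x - arg2 y) / 2 := by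
    rw [sin_sq_eq_half_sub]
    ring_nf
  rw [h, cos_sub, EuclideanSpace.dist_eq, sq_sqrt (by positivity), Fin.sum_univ_two,
    Real.dist_eq, Real.dist_eq, sq_abs, sq_abs, ← norm_mul_cos_arg2 x, ← norm_mul_cos_arg2 y,
    ← norm_mul_sin_arg2 x, ← norm_mul_sin_arg2 y]
  linear_combination ‖x‖ ^ 2 * sin_sq_add_cos_sq (arg2 x) + ‖y‖ ^ 2 * sin_sq_add_cos_sq (arg2 y)

lemma norm_mul_abs_sin_le_dist {x y : V2} (h : ‖y‖ ≤ ‖x‖) :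
    ‖y‖ * |sin ((arg2 x - arg2 y) / 2)| ≤ dist x y := by
  refine abs_le_of_sq_le_sq' ?_ dist_nonneg |>.2
  rw [dist_sq_polar, mul_pow, sq_abs]
  have h1 : ‖y‖ ^ 2 ≤ ‖x‖ * ‖y‖ := by nlinarith [norm_nonneg y]
  have h2 := sq_nonneg (sin ((arg2 x - arg2 y) / 2))
  nlinarith [mul_le_mul_of_nonneg_right h1 h2, sq_nonneg (‖x‖ - ‖y‖),
    mul_nonneg (sq_nonneg ‖y‖) h2]

lemma utau_eq (hM : 1 < M) (hτ0 : 0 ≤ τ) (x : V2) :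
    utau M τ x = ‖x‖ ^ (muM M τ / cM M τ) * wtau M τ (arg2 x) := by
  rw [utau]
  split_ifs with h
  · rw [h, norm_zero, zero_rpow (exponent_pos hM hτ0).ne', zero_mul]
  · rfl

lemma rpow_sub_rpow_le {r ρ β : ℝ} (hρ : 0 ≤ ρ) (h : ρ ≤ r) (hβ0 : 0 ≤ β) (hβ1 : β ≤ 1) :
    r ^ β - ρ ^ β ≤ (r - ρ) ^ β := by
  have := Real.rpow_add_le_add_rpow (sub_nonneg.mpr h) hρ hβ0 hβ1
  rw [sub_add_cancel] at this
  linarith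

lemma utau_holder_of_norm_le (hM : 1 < M) (hτ0 : 0 ≤ τ) (hτ1 : τ ≤ 1) {x y : V2}
    (h : ‖y‖ ≤ ‖x‖) :
    |utau M τ x - utau M τ y| ≤ (1 + M ^ τ * π) * dist x y ^ (muM M τ / cM M τ) := by
  have hβ0 := exponent_pos hM hτ0
  have hβ1 := exponent_le_one hM hτ0 hτ1
  have hL : 0 < M ^ τ := rpow_pos_of_pos (by linarith) _
  rw [utau_eq hM hτ0, utau_eq hM hτ0]
  set β := muM M τ / cM M τ
  set S := |sin ((arg2 x - arg2 y) / 2)| with hS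
  have hS1 : S ≤ 1 := abs_sin_le_one _
  have hS0 : 0 ≤ S := abs_nonneg _
  have hradial : ‖x‖ ^ β - ‖y‖ ^ β ≤ dist x y ^ β := by
    refine (rpow_sub_rpow_le (norm_nonneg y) h hβ0.le hβ1).trans ?_
    refine rpow_le_rpow (sub_nonneg.mpr h) ?_ hβ0.le
    rw [dist_eq_norm]
    exact norm_sub_norm_le x y
  have hangular : ‖y‖ ^ β * S ≤ dist x y ^ β := by
    calc ‖y‖ ^ β * S ≤ ‖y‖ ^ β * S ^ β := by
          gcongr
          exact self_le_rpow_of_le_one hS0 hS1 hβ1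
      _ = (‖y‖ * S) ^ β := (mul_rpow (norm_nonneg y) hS0).symm
      _ ≤ dist x y ^ β :=
          rpow_le_rpow (by positivity) (norm_mul_abs_sin_le_dist h) hβ0.le
  have hmono : ‖y‖ ^ β ≤ ‖x‖ ^ β := rpow_le_rpow (norm_nonneg y) h hβ0.le
  have hw := wtau_chord hM hτ0 hτ1 (arg2_mem x) (arg2_mem y)
  calc |‖x‖ ^ β * wtau M τ (arg2 x) - ‖y‖ ^ β * wtau M τ (arg2 y)|
      = |(‖x‖ ^ β - ‖y‖ ^ β) * wtau M τ (arg2 x)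
          + ‖y‖ ^ β * (wtau M τ (arg2 x) - wtau M τ (arg2 y))| := by ring_nf
    _ ≤ (‖x‖ ^ β - ‖y‖ ^ β) * |wtau M τ (arg2 x)|
          + ‖y‖ ^ β * |wtau M τ (arg2 x) - wtau M τ (arg2 y)| := by
        refine (abs_add_le _ _).trans_eq ?_
        rw [abs_mul, abs_mul, abs_of_nonneg (sub_nonneg.mpr hmono),
          abs_of_nonneg (rpow_nonneg (norm_nonneg y) β)]
    _ ≤ (‖x‖ ^ β - ‖y‖ ^ β) * 1 + ‖y‖ ^ β * (M ^ τ * (π * S)) := by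
        gcongr
        exact abs_wtau_le_one hM hτ1 _
    _ = (‖x‖ ^ β - ‖y‖ ^ β) + M ^ τ * π * (‖y‖ ^ β * S) := by ring
    _ ≤ dist x y ^ β + M ^ τ * π * dist x y ^ β := by gcongr
    _ = (1 + M ^ τ * π) * dist x y ^ β := by ring

lemma utau_holder (hM : 1 < M) (hτ0 : 0 ≤ τ) (hτ1 : τ ≤ 1) (x y : V2) :
    |utau M τ x - utau M τ y| ≤ (1 + M ^ τ * π) * dist x y ^ (muM M τ / cM M τ) := by
  rcases le_total ‖y‖ ‖x‖ with h | h
  · exact utau_holder_of_norm_le hM hτ0 hτ1 h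
  · rw [abs_sub_comm, dist_comm]
    exact utau_holder_of_norm_le hM hτ0 hτ1 h

lemma norm_single_zero {t : ℝ} (ht : 0 ≤ t) : ‖(EuclideanSpace.single 0 t : V2)‖ = t := by
  rw [PiLp.norm_single, Real.norm_of_nonneg ht]

lemma arg2_single_zero {t : ℝ} (ht : 0 ≤ t) : arg2 (EuclideanSpace.single 0 t) = 0 := by
  have h : Complex.arg (Complex.mk t 0) = 0 := Complex.arg_ofReal_of_nonneg ht
  simp [arg2, h]

lemma abs_utau_single_zero (hM : 1 < M) (hτ0 : 0 ≤ τ) {t : ℝ} (ht : 0 ≤ t) :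
    |utau M τ (EuclideanSpace.single 0 t)|
      = t ^ (muM M τ / cM M τ) * sin (arctan (M ^ (-(1 - τ) / 2))) := by
  have h : 0 < sin (arctan (M ^ (-(1 - τ) / 2))) := by
    rw [sin_arctan_eq_mul_cos]
    exact mul_pos (amplitude_pos hM) (cos_arctan_pos _)
  rw [utau_eq hM hτ0, norm_single_zero ht, arg2_single_zero ht, wtau_of_lt_pi le_rfl pi_pos,
    wbase_zero hM hτ0, abs_mul, abs_neg, abs_of_pos h, abs_of_nonneg (rpow_nonneg ht _)]

lemma not_utau_holder (hM : 1 < M) (hτ0 : 0 ≤ τ) {α : ℝ} (hα : muM M τ / cM M τ < α) :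
    ¬ ∃ U : Set V2, U ∈ nhds (0 : V2) ∧ ∃ C > (0 : ℝ),
      ∀ x ∈ U ∩ Metric.closedBall (0 : V2) 1, ∀ y ∈ U ∩ Metric.closedBall (0 : V2) 1,
        |utau M τ x - utau M τ y| ≤ C * dist x y ^ α := by
  rintro ⟨U, hU, C, -, hUC⟩
  obtain ⟨ε, hε, hball⟩ := Metric.mem_nhds_iff.mp hU
  set k := sin (arctan (M ^ (-(1 - τ) / 2))) with hk_def
  have hk : 0 < k := by
    rw [hk_def, sin_arctan_eq_mul_cos]
    exact mul_pos (amplitude_pos hM) (cos_arctan_pos _)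
  have hbound : ∀ t ∈ Ioo 0 (min ε 1), k ≤ C * t ^ (α - muM M τ / cM M τ) := by
    rintro t ⟨ht0, ht1⟩
    have hx : (EuclideanSpace.single 0 t : V2) ∈ U ∩ Metric.closedBall (0 : V2) 1 := by
      constructor
      · apply hball
        rw [mem_ball_zero_iff, norm_single_zero ht0.le]
        exact ht1.trans_le (min_le_left _ _)
      · rw [mem_closedBall_zero_iff, norm_single_zero ht0.le]
        exact (ht1.trans_le (min_le_right _ _)).le
    have h := hUC _ hx 0 ⟨mem_of_mem_nhds hU, Metric.mem_closedBall_self zero_le_one⟩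
    rw [show utau M τ 0 = 0 from if_pos rfl, sub_zero, abs_utau_single_zero hM hτ0 ht0.le,
      dist_zero_right, norm_single_zero ht0.le, ← hk_def] at h
    rw [rpow_sub ht0, ← mul_div_assoc, le_div_iff₀ (rpow_pos_of_pos ht0 _)]
    linarith
  have hlim : Filter.Tendsto (fun t : ℝ => C * t ^ (α - muM M τ / cM M τ))
      (nhdsWithin 0 (Ioi 0)) (nhds 0) := by
    have h := (continuousAt_rpow_const (0 : ℝ) (α - muM M τ / cM M τ)
      (Or.inr (sub_pos.mpr hα).le)).tendsto.const_mul C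
    rw [zero_rpow (sub_pos.mpr hα).ne', mul_zero] at h
    exact h.mono_left nhdsWithin_le_nhds
  refine hk.not_ge (ge_of_tendsto hlim ?_)
  filter_upwards [Ioo_mem_nhdsGT (lt_min hε one_pos)] with t ht using hbound t ht

end Parameters

/-- `u_τ` is Hölder continuous with exponent `μ/c` on the closed unit
disk, and for no `α ∈ (μ/c, 1]` is `u_τ` `α`-Hölder continuous on (the part inside the
closed unit disk of) any neighborhood of `0`: the Hölder exponent of `u_τ` is exactly
`μ/c`. -/
theorem stmt17 (M τ : ℝ) (hM : 1 < M) (hτ0 : 0 ≤ τ) (hτ1 : τ ≤ 1) :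
    (∃ C > (0 : ℝ), ∀ x ∈ Metric.closedBall (0 : V2) 1, ∀ y ∈ Metric.closedBall (0 : V2) 1,
        |utau M τ x - utau M τ y| ≤ C * dist x y ^ (muM M τ / cM M τ)) ∧
      ∀ α : ℝ, muM M τ / cM M τ < α → α ≤ 1 →
        ¬ ∃ U : Set V2, U ∈ nhds (0 : V2) ∧ ∃ C > (0 : ℝ),
          ∀ x ∈ U ∩ Metric.closedBall (0 : V2) 1, ∀ y ∈ U ∩ Metric.closedBall (0 : V2) 1,
            |utau M τ x - utau M τ y| ≤ C * dist x y ^ α := by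
  refine ⟨⟨1 + M ^ τ * π, ?_, fun x _ y _ => utau_holder hM hτ0 hτ1 x y⟩,
    fun α hα _ => not_utau_holder hM hτ0 hα⟩
  have : 0 < M ^ τ := rpow_pos_of_pos (by linarith) _
  positivity
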